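/- arXiv:1606.03572 — 3 statements merged into one kernel-verified Lean document; each statement's English description precedes it below -/
import Mathlib

section
/- Let C be a finite nonempty type of class labels and let x be a multiset over C having a unique most frequent label c₁, with gap j = count(c₁,x) − max_{c≠c₁} count(c,x) ≥ 1. Then for every multiset y over C with ‖x−y‖₁ < j, the label c₁ is also the unique most frequent label of y; consequently u(c,x) = u(c,y) for every label c ∈ C. -/
/-- The ℓ₁ distance between two multisets: the minimum number of single-record
additions or removals transforming `x` into `y`. -/
def msDist {C : Type*} [DecidableEq C] (x y : Multiset C) : ℕ :=
  (x - y).card + (y - x).card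

/-- The scoring function `u(c, x)`: 1 if `c` is a most frequent label of `x`, 0 otherwise. -/
noncomputable def score {C : Type*} [Fintype C] [DecidableEq C] (c : C) (x : Multiset C) : ℝ :=
  if x.count c = Finset.univ.sup (fun c' => x.count c') then 1 else 0

theorem score_of_unique {C : Type*} [Fintype C] [DecidableEq C] (z : Multiset C) (c₁ : C)
    (h : ∀ c : C, c ≠ c₁ → z.count c < z.count c₁) (c : C) :
    score c z = if c = c₁ then 1 else 0 := by
  have hs : Finset.univ.sup (fun c' => z.count c') = z.count c₁ := by
    apply le_antisymm
    · apply Finset.sup_le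
      intro b _
      by_cases hb : b = c₁
      · rw [hb]
      · exact (h b hb).le
    · exact Finset.le_sup (f := fun c' => z.count c') (Finset.mem_univ c₁)
  unfold score
  rw [hs]
  by_cases hc : c = c₁
  · simp [hc]
  · simp [hc, (h c hc).ne]

/-- If `x` has a unique most frequent label `c₁` with gap `j ≥ 1`, then every multiset `y`
at distance strictly less than `j` from `x` also has `c₁` as its unique most frequent label,
and the scoring function is unchanged: `u(c, x) = u(c, y)` for every label `c`. -/
theorem stmt0 {C : Type*} [Fintype C] [DecidableEq C] [Nonempty C]
    (x : Multiset C) (c₁ : C) (j : ℕ)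
    (huniq : ∀ c : C, c ≠ c₁ → x.count c < x.count c₁)
    (hj : j = x.count c₁ - (Finset.univ.erase c₁).sup (fun c => x.count c))
    (hj1 : 1 ≤ j) :
    ∀ y : Multiset C, msDist x y < j →
      (∀ c : C, c ≠ c₁ → y.count c < y.count c₁) ∧
      (∀ c : C, score c x = score c y) := by
  intro y hy
  have key : ∀ c : C, c ≠ c₁ → y.count c < y.count c₁ := by
    intro c hc
    have h1 : x.count c ≤ (Finset.univ.erase c₁).sup (fun c => x.count c) :=
      Finset.le_sup (f := fun c => x.count c) (by simp [hc])
    have h2 := Multiset.count_le_card c₁ (x - y)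
    have h3 := Multiset.count_le_card c (y - x)
    rw [Multiset.count_sub] at h2 h3
    unfold msDist at hy
    omega
  refine ⟨key, fun c => ?_⟩
  rw [score_of_unique x c₁ huniq, score_of_unique y c₁ key]
end

section
/- Let C be a finite type of class labels with at least two elements, and let x be a multiset over C having a unique most frequent label with gap j ≥ 1. Then for every natural number k ≥ j there exist a multiset y over C with ‖x−y‖₁ ≤ k and a label c ∈ C such that u(c,x) ≠ u(c,y). -/
/-- If `C` has at least two labels and `x` has a unique most frequent label `c₁` with gap
`j ≥ 1`, then for every `k ≥ j` there is a multiset `y` at distance at most `k` from `x`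
and a label `c` whose score differs between `x` and `y`. -/
theorem stmt1 {C : Type*} [Fintype C] [DecidableEq C] [Nontrivial C]
    (x : Multiset C) (c₁ : C) (j : ℕ)
    (huniq : ∀ c : C, c ≠ c₁ → x.count c < x.count c₁)
    (hj : j = x.count c₁ - (Finset.univ.erase c₁).sup (fun c => x.count c))
    (hj1 : 1 ≤ j) :
    ∀ k : ℕ, j ≤ k →
      ∃ (y : Multiset C) (c : C), msDist x y ≤ k ∧ score c x ≠ score c y := by
  intro k hk
  have hne : (Finset.univ.erase c₁).Nonempty := by
    obtain ⟨c, hc⟩ := exists_ne c₁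
    exact ⟨c, by simp [hc]⟩
  obtain ⟨c₂, hc₂, hsup⟩ :=
    Finset.exists_mem_eq_sup (Finset.univ.erase c₁) hne (fun c => x.count c)
  have hc₂ne : c₂ ≠ c₁ := Finset.ne_of_mem_erase hc₂
  have hlt := huniq c₂ hc₂ne
  rw [hsup] at hj
  refine ⟨x + Multiset.replicate j c₂, c₂, ?_, ?_⟩
  · have h0 : x - (x + Multiset.replicate j c₂) = 0 :=
      tsub_eq_zero_of_le (Multiset.le_add_right _ _)
    simpa [msDist, h0] using hk
  · have hx : score c₂ x = 0 := by
      unfold score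
      rw [if_neg]
      intro h
      have h1 : x.count c₁ ≤ Finset.univ.sup (fun c' => x.count c') :=
        Finset.le_sup (f := fun c' => x.count c') (Finset.mem_univ c₁)
      omega
    have hy : score c₂ (x + Multiset.replicate j c₂) = 1 := by
      unfold score
      rw [if_pos]
      apply le_antisymm
      · exact Finset.le_sup (f := fun c' => (x + Multiset.replicate j c₂).count c')
          (Finset.mem_univ c₂)
      · apply Finset.sup_le
        intro c _
        by_cases h : c = c₂
        · rw [h]
        · have h2 : x.count c ≤ x.count c₁ := by
            by_cases h3 : c = c₁
            · rw [h3]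
            · exact (huniq c h3).le
          simp only [Multiset.count_add, Multiset.count_replicate, if_neg (Ne.symm h), if_true]
          omega
    rw [hx, hy]
    exact zero_ne_one
end

section
/- Let C be a finite nonempty type of class labels and let x be a multiset over C having a unique least frequent label c_min (minimizing count over all of C), with gap j' = (min_{c≠c_min} count(c,x)) − count(c_min,x) ≥ 1. Then for every multiset y over C with ‖x−y‖₁ < j', the label c_min is also the unique least frequent label of y; consequently u_min(c,x) = u_min(c,y) for every label c ∈ C. -/
/-- The least-frequent scoring function `u_min(c, x)`: 1 if `c` is a least frequent label
of `x` (minimizing the count over all of `C`), 0 otherwise. -/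
noncomputable def scoreMin {C : Type*} [Fintype C] [DecidableEq C] [Nonempty C]
    (c : C) (x : Multiset C) : ℝ :=
  if x.count c = Finset.univ.inf' Finset.univ_nonempty (fun c' => x.count c') then 1 else 0

theorem scoreMin_of_unique {C : Type*} [Fintype C] [DecidableEq C] [Nonempty C]
    (x : Multiset C) (m : C) (h : ∀ c : C, c ≠ m → x.count m < x.count c) (c : C) :
    scoreMin c x = if c = m then 1 else 0 := by
  have hi : Finset.univ.inf' Finset.univ_nonempty (fun c' => x.count c') = x.count m := by
    apply le_antisymm
    · exact Finset.inf'_le (fun c' => x.count c') (Finset.mem_univ m)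
    · apply Finset.le_inf'
      intro b _
      by_cases hb : b = m
      · rw [hb]
      · exact (h b hb).le
  unfold scoreMin
  rw [hi]
  by_cases hc : c = m
  · simp [hc]
  · rw [if_neg (h c hc).ne', if_neg hc]

/-- If `x` has a unique least frequent label `cmin` with gap
`j' = (min_{c ≠ cmin} count(c,x)) − count(cmin,x) ≥ 1`, then every multiset `y` at distance
strictly less than `j'` from `x` also has `cmin` as its unique least frequent label, and the
least-frequent scoring function is unchanged: `u_min(c,x) = u_min(c,y)` for every label `c`. -/
theorem stmt5 {C : Type*} [Fintype C] [DecidableEq C] [Nonempty C]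
    (x : Multiset C) (cmin : C) (j' : ℕ)
    (hne : (Finset.univ.erase cmin).Nonempty)
    (huniq : ∀ c : C, c ≠ cmin → x.count cmin < x.count c)
    (hj : j' = (Finset.univ.erase cmin).inf' hne (fun c => x.count c) - x.count cmin)
    (hj1 : 1 ≤ j') :
    ∀ y : Multiset C, msDist x y < j' →
      (∀ c : C, c ≠ cmin → y.count cmin < y.count c) ∧
      (∀ c : C, scoreMin c x = scoreMin c y) := by
  intro y hy
  have key : ∀ c : C, c ≠ cmin → y.count cmin < y.count c := by
    intro c hc
    have h1 : (Finset.univ.erase cmin).inf' hne (fun c => x.count c) ≤ x.count c :=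
      Finset.inf'_le (fun c => x.count c) (Finset.mem_erase.2 ⟨hc, Finset.mem_univ c⟩)
    have h2 := Multiset.count_le_card c (x - y)
    have h3 := Multiset.count_le_card cmin (y - x)
    rw [Multiset.count_sub] at h2 h3
    unfold msDist at hy
    omega
  refine ⟨key, fun c => ?_⟩
  rw [scoreMin_of_unique x cmin huniq, scoreMin_of_unique y cmin key]
end
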